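/- Let G be a finite simple graph, u ≠ v two vertices, and C a set of vertices with u, v ∉ C such that every edge of G with an endpoint in C has its other endpoint in C ∪ {u, v} ({u,v} is a separator cutting off C). If α(G[C ∪ {u, v}]) = α(G[C ∪ {u}]) = α(G[C ∪ {v}]) = α(G[C]), then α(G) = α(G[C]) + α(G[V \ (C ∪ {u, v})]). -/

import Mathlib

/-- A set of vertices is independent if its elements are pairwise non-adjacent. -/
def IsIndepSet {V : Type*} (G : SimpleGraph V) (s : Set V) : Prop :=
  s.Pairwise fun a b => ¬ G.Adj a b

/-- A finset of vertices is a maximum independent set if it is independent and of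
maximum cardinality among independent sets. -/
def IsMaxIndepSet {V : Type*} (G : SimpleGraph V) (I : Finset V) : Prop :=
  IsIndepSet G ↑I ∧ ∀ J : Finset V, IsIndepSet G ↑J → J.card ≤ I.card

/-- The independence number of a graph: the maximum cardinality of an independent set. -/
noncomputable def indepNum {V : Type*} (G : SimpleGraph V) : ℕ :=
  sSup {n | ∃ s : Finset V, IsIndepSet G ↑s ∧ s.card = n}

theorem card_le_indepNum_aux {V : Type*} [Finite V] (G : SimpleGraph V) (s : Finset V)
    (hs : IsIndepSet G ↑s) : s.card ≤ indepNum G := by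
  have := Fintype.ofFinite V
  refine le_csSup ⟨Fintype.card V, ?_⟩ ⟨s, hs, rfl⟩
  rintro n ⟨t, -, rfl⟩
  exact t.card_le_univ

theorem exists_indepNum_aux {V : Type*} [Finite V] (G : SimpleGraph V) :
    ∃ s : Finset V, IsIndepSet G ↑s ∧ s.card = indepNum G := by
  have := Fintype.ofFinite V
  refine Nat.sSup_mem (s := {n | ∃ s : Finset V, IsIndepSet G ↑s ∧ s.card = n})
    ⟨0, ∅, by simp [IsIndepSet], rfl⟩ ⟨Fintype.card V, ?_⟩
  rintro n ⟨t, -, rfl⟩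
  exact t.card_le_univ

theorem card_le_induce_aux {V : Type*} [Finite V] (G : SimpleGraph V) (A : Set V) (s : Finset V)
    (hs : IsIndepSet G ↑s) (hA : ∀ x ∈ s, x ∈ A) : s.card ≤ indepNum (G.induce A) := by
  classical
  have hc : (s.subtype (· ∈ A)).card = s.card := by
    rw [Finset.card_subtype, Finset.filter_true_of_mem hA]
  rw [← hc]
  apply card_le_indepNum_aux
  intro a ha b hb hab
  simp only [Finset.mem_coe, Finset.mem_subtype] at ha hb
  exact hs ha hb (fun h => hab (Subtype.ext h))

theorem exists_induce_aux {V : Type*} [Finite V] (G : SimpleGraph V) (A : Set V) :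
    ∃ s : Finset V, IsIndepSet G ↑s ∧ (∀ x ∈ s, x ∈ A) ∧ s.card = indepNum (G.induce A) := by
  obtain ⟨t, ht, hc⟩ := exists_indepNum_aux (G.induce A)
  refine ⟨t.map (Function.Embedding.subtype _), ?_, ?_, by rw [Finset.card_map, hc]⟩
  · intro a ha b hb hab
    simp only [Finset.mem_coe, Finset.mem_map] at ha hb
    obtain ⟨a', ha', rfl⟩ := ha
    obtain ⟨b', hb', rfl⟩ := hb
    exact ht ha' hb' (fun h => hab (by rw [h]))
  · intro x hx
    obtain ⟨a', -, rfl⟩ := Finset.mem_map.1 hx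
    exact a'.2

/-- Two-separator rule: if {u, v} cuts off C and
α(G[C ∪ {u, v}]) = α(G[C ∪ {u}]) = α(G[C ∪ {v}]) = α(G[C]), then
α(G) = α(G[C]) + α(G[V \ (C ∪ {u, v})]). -/
theorem two_separator_equal {V : Type*} [Fintype V] [DecidableEq V]
    (G : SimpleGraph V) (u v : V) (huv : u ≠ v) (C : Set V) (hu : u ∉ C) (hv : v ∉ C)
    (hsep : ∀ a b : V, G.Adj a b → a ∈ C → b ∈ C ∪ {u, v})
    (h1 : indepNum (G.induce (C ∪ {u, v})) = indepNum (G.induce C))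
    (h2 : indepNum (G.induce (C ∪ {u})) = indepNum (G.induce C))
    (h3 : indepNum (G.induce (C ∪ {v})) = indepNum (G.induce C)) :
    indepNum G = indepNum (G.induce C) + indepNum (G.induce ((C ∪ {u, v})ᶜ)) := by
  classical
  apply le_antisymm
  · obtain ⟨I, hI, hc⟩ := exists_indepNum_aux G
    rw [← hc, ← h1, ← Finset.card_filter_add_card_filter_not (s := I) (· ∈ C ∪ {u, v})]
    apply add_le_add
    · apply card_le_induce_aux
      · exact hI.mono (Finset.coe_subset.2 (Finset.filter_subset _ _))
      · intro x hx
        exact (Finset.mem_filter.1 hx).2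
    · apply card_le_induce_aux
      · exact hI.mono (Finset.coe_subset.2 (Finset.filter_subset _ _))
      · intro x hx
        exact (Finset.mem_filter.1 hx).2
  · obtain ⟨I, hI, hIC, hIc⟩ := exists_induce_aux G C
    obtain ⟨J, hJ, hJC, hJc⟩ := exists_induce_aux G ((C ∪ {u, v})ᶜ)
    have hd : Disjoint I J := by
      rw [Finset.disjoint_left]
      intro x hx hx'
      exact hJC x hx' (Or.inl (hIC x hx))
    rw [← hIc, ← hJc, ← Finset.card_union_of_disjoint hd]
    apply card_le_indepNum_aux
    intro a ha b hb hab hadj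
    rcases Finset.mem_union.1 (Finset.mem_coe.1 ha) with ha | ha <;>
    rcases Finset.mem_union.1 (Finset.mem_coe.1 hb) with hb | hb
    · exact hI ha hb hab hadj
    · exact hJC b hb (hsep a b hadj (hIC a ha))
    · exact hJC a ha (hsep b a hadj.symm (hIC b hb))
    · exact hJ ha hb hab hadj
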